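/- Let λ : [0,1] → ℝ satisfy Assumption 1 (with subpower function φ) and Assumption 2 (with constants c₀, y₀, β), with trace γ and Loewner maps g_t. Then there exists a subpower function ψ, depending only on φ, c₀ and β, such that for every n ≥ 1 and every 0 ≤ k ≤ n − 1 (with t_k = k/n) there exists s ∈ [0, 2/n] with γ_k(s) := g_{t_k}(γ(t_k + s)) − λ(t_k) ∈ A_{n, 2√2, ψ}. -/

import Mathlib

open MeasureTheory Filter Set

open MeasureTheory Filter Set

noncomputable section

/-- The open upper half-plane. -/
def UHP : Set ℂ := {z : ℂ | 0 < z.im}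

/-- `f` is the forward Loewner flow of the driver `lam` started at `z`,
existing (staying in the upper half-plane) on `[0, t]`. -/
def IsFwdSolOn (lam : ℝ → ℝ) (z : ℂ) (f : ℝ → ℂ) (t : ℝ) : Prop :=
  f 0 = z ∧ ∀ s ∈ Set.Icc (0:ℝ) t, 0 < (f s).im ∧
    HasDerivAt f (2 / (f s - (lam s : ℂ))) s

/-- A (forward) Loewner chain on `[0, T]` for the driver `lam`: the conformal maps `g t`
from their domains `H t` (the set of points whose Loewner flow exists up to time `t`)
onto the upper half-plane, together with the inverse maps `finv t`. -/
structure FwdLoewnerChain (lam : ℝ → ℝ) (T : ℝ) where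
  g : ℝ → ℂ → ℂ
  H : ℝ → Set ℂ
  finv : ℝ → ℂ → ℂ
  mem_H : ∀ t ∈ Set.Icc (0:ℝ) T, ∀ z : ℂ,
    z ∈ H t ↔ (0 < z.im ∧ IsFwdSolOn lam z (fun s => g s z) t)
  bijOn : ∀ t ∈ Set.Icc (0:ℝ) T, Set.BijOn (g t) (H t) UHP
  g_holo : ∀ t ∈ Set.Icc (0:ℝ) T, DifferentiableOn ℂ (g t) (H t)
  finv_maps : ∀ t ∈ Set.Icc (0:ℝ) T, ∀ w ∈ UHP, finv t w ∈ H t ∧ g t (finv t w) = w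
  finv_holo : ∀ t ∈ Set.Icc (0:ℝ) T, DifferentiableOn ℂ (finv t) UHP

/-- `γ` is the trace of the Loewner chain `ch` with driver `lam` on `[0,T]`:
the continuous curve `γ t = lim_{y→0+} g_t⁻¹ (lam t + i y)`. -/
def HasTrace (lam : ℝ → ℝ) (T : ℝ) (ch : FwdLoewnerChain lam T) (γ : ℝ → ℂ) : Prop :=
  ContinuousOn γ (Set.Icc 0 T) ∧
  ∀ t ∈ Set.Icc (0:ℝ) T,
    Tendsto (fun y : ℝ => ch.finv t ((lam t : ℂ) + y * Complex.I))
      (nhdsWithin 0 (Set.Ioi 0)) (nhds (γ t))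

/-- A subpower function: a nonnegative function growing slower than any positive power. -/
def IsSubpower (φ : ℝ → ℝ) : Prop :=
  (∀ x, 0 ≤ φ x) ∧ ∀ ε : ℝ, 0 < ε → Tendsto (fun x => φ x / x ^ ε) atTop (nhds 0)

/-- The modulus of continuity `osc(f, δ)` of `f` on `[0,1]`. -/
def osc (f : ℝ → ℝ) (δ : ℝ) : ℝ :=
  sSup {d : ℝ | ∃ s ∈ Set.Icc (0:ℝ) 1, ∃ t ∈ Set.Icc (0:ℝ) 1, |t - s| ≤ δ ∧ d = |f t - f s|}

/-- The box `A_{n,c,φ} = {x + iy ∈ ℍ : |x| ≤ φ(n)/√n, 1/(√n φ(n)) ≤ y ≤ c/√n}`. -/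
def boxA (n : ℕ) (c : ℝ) (φ : ℝ → ℝ) : Set ℂ :=
  {z : ℂ | 0 < z.im ∧ |z.re| ≤ φ n / Real.sqrt n ∧
    1 / (Real.sqrt n * φ n) ≤ z.im ∧ z.im ≤ c / Real.sqrt n}


/-! ### Elementary facts about solutions of the Loewner ODE -/

/-- `Z` solves the Loewner equation on `[a,b]` and stays in the upper half-plane. -/
def Sol (lam : ℝ → ℝ) (Z : ℝ → ℂ) (a b : ℝ) : Prop :=
  ∀ r ∈ Set.Icc a b, 0 < (Z r).im ∧ HasDerivAt Z (2 / (Z r - (lam r : ℂ))) r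

lemma Sol.mono {lam : ℝ → ℝ} {Z : ℝ → ℂ} {a b a' b' : ℝ} (h : Sol lam Z a b)
    (ha : a ≤ a') (hb : b' ≤ b) : Sol lam Z a' b' :=
  fun r hr => h r ⟨ha.trans hr.1, hr.2.trans hb⟩

lemma two_div_im (z : ℂ) : (2 / z : ℂ).im = -(2 * z.im / Complex.normSq z) := by
  simp [Complex.div_im]

lemma two_div_re (z : ℂ) : (2 / z : ℂ).re = 2 * z.re / Complex.normSq z := by
  simp [Complex.div_re]

lemma hasDerivAt_im {Z : ℝ → ℂ} {v : ℂ} {r : ℝ} (h : HasDerivAt Z v r) :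
    HasDerivAt (fun r => (Z r).im) v.im r := by
  exact (Complex.imCLM.hasFDerivAt (x := Z r)).comp_hasDerivAt r h

lemma hasDerivAt_re {Z : ℝ → ℂ} {v : ℂ} {r : ℝ} (h : HasDerivAt Z v r) :
    HasDerivAt (fun r => (Z r).re) v.re r := by
  exact (Complex.reCLM.hasFDerivAt (x := Z r)).comp_hasDerivAt r h

lemma Sol.im_deriv {lam : ℝ → ℝ} {Z : ℝ → ℂ} {a b : ℝ} (h : Sol lam Z a b) {r : ℝ}
    (hr : r ∈ Set.Icc a b) :
    HasDerivAt (fun r => (Z r).im) (-(2 * (Z r).im / Complex.normSq (Z r - lam r))) r := by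
  have := hasDerivAt_im (h r hr).2
  rw [two_div_im] at this
  simpa using this

lemma Sol.re_deriv {lam : ℝ → ℝ} {Z : ℝ → ℂ} {a b : ℝ} (h : Sol lam Z a b) {r : ℝ}
    (hr : r ∈ Set.Icc a b) :
    HasDerivAt (fun r => (Z r).re) (2 * ((Z r).re - lam r) / Complex.normSq (Z r - lam r)) r := by
  have := hasDerivAt_re (h r hr).2
  rw [two_div_re] at this
  simpa using this

lemma Sol.normSq_pos {lam : ℝ → ℝ} {Z : ℝ → ℂ} {a b : ℝ} (h : Sol lam Z a b) {r : ℝ}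
    (hr : r ∈ Set.Icc a b) : (Z r).im ^ 2 ≤ Complex.normSq (Z r - lam r) ∧
      0 < Complex.normSq (Z r - lam r) := by
  have h1 := (h r hr).1
  have : (Z r).im ^ 2 ≤ Complex.normSq (Z r - lam r) := by
    rw [Complex.normSq_apply]; simp; nlinarith [sq_nonneg ((Z r).re - lam r)]
  exact ⟨this, lt_of_lt_of_le (by positivity) this⟩

lemma Sol.cont {lam : ℝ → ℝ} {Z : ℝ → ℂ} {a b : ℝ} (h : Sol lam Z a b) :
    ContinuousOn Z (Set.Icc a b) :=
  fun r hr => (h r hr).2.continuousAt.continuousWithinAt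

/-- a monotonicity principle -/
lemma mono_of_deriv {F F' : ℝ → ℝ} {a b : ℝ} (hab : a ≤ b)
    (hF : ∀ r ∈ Set.Icc a b, HasDerivAt F (F' r) r) (h0 : ∀ r ∈ Set.Icc a b, 0 ≤ F' r) :
    F a ≤ F b := by
  have : MonotoneOn F (Set.Icc a b) := by
    apply monotoneOn_of_deriv_nonneg (convex_Icc a b)
    · exact fun r hr => (hF r hr).continuousAt.continuousWithinAt
    · intro r hr
      exact (hF r (interior_subset hr)).differentiableAt.differentiableWithinAt
    · intro r hr
      rw [(hF r (interior_subset hr)).deriv]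
      exact h0 r (interior_subset hr)
  exact this (Set.left_mem_Icc.2 hab) (Set.right_mem_Icc.2 hab) hab

lemma Sol.im_anti {lam : ℝ → ℝ} {Z : ℝ → ℂ} {a b : ℝ} (h : Sol lam Z a b) (hab : a ≤ b) :
    (Z b).im ≤ (Z a).im := by
  have := mono_of_deriv (F := fun r => -(Z r).im) hab (fun r hr => (h.im_deriv hr).neg) (by
    intro r hr
    have := (h r hr).1
    have := (h.normSq_pos hr).2
    rw [neg_neg]; positivity)
  linarith

lemma Sol.im_sq {lam : ℝ → ℝ} {Z : ℝ → ℂ} {a b : ℝ} (h : Sol lam Z a b) (hab : a ≤ b) :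
    (Z a).im ^ 2 - 4 * (b - a) ≤ (Z b).im ^ 2 := by
  have := mono_of_deriv (F := fun r => (Z r).im ^ 2 + 4 * r) hab
    (fun r hr => ((h.im_deriv hr).pow 2).add ((hasDerivAt_id r).const_mul 4)) (by
    intro r hr
    have h1 := (h r hr).1
    obtain ⟨h2, h3⟩ := h.normSq_pos hr
    have : (Z r).im ^ 2 / Complex.normSq (Z r - lam r) ≤ 1 := (div_le_one h3).2 h2
    have e : (Z r).im * (2 * (Z r).im / Complex.normSq (Z r - lam r))
       = 2 * ((Z r).im ^ 2 / Complex.normSq (Z r - lam r)) := by ring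
    simp
    nlinarith)
  linarith

lemma Sol.im_exp {lam : ℝ → ℝ} {Z : ℝ → ℂ} {a b d : ℝ} (h : Sol lam Z a b) (hab : a ≤ b)
    (hd : 0 < d) (hZ : ∀ r ∈ Set.Icc a b, d ≤ ‖Z r - lam r‖) :
    (Z a).im * Real.exp (-(2 / d ^ 2 * (b - a))) ≤ (Z b).im := by
  have := mono_of_deriv (F := fun r => (Z r).im * Real.exp (2 / d ^ 2 * r)) hab
    (fun r hr => (h.im_deriv hr).mul (((hasDerivAt_id r).const_mul (2 / d ^ 2)).exp)) (by
    intro r hr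
    have h1 := (h r hr).1
    have h4 : d ^ 2 ≤ Complex.normSq (Z r - lam r) := by
      rw [Complex.normSq_eq_norm_sq]
      exact pow_le_pow_left₀ hd.le (hZ r hr) 2
    have : 2 * (Z r).im / Complex.normSq (Z r - lam r) ≤ 2 * (Z r).im / d ^ 2 := by gcongr
    have e : 2 * (Z r).im / d ^ 2 = (Z r).im * (2 / d ^ 2) := by ring
    simp only [id, mul_one]
    have := Real.exp_pos (2 / d ^ 2 * r)
    nlinarith)
  have e : Real.exp (-(2 / d ^ 2 * (b - a))) =
      Real.exp (2 / d ^ 2 * a) * Real.exp (-(2 / d ^ 2 * b)) := by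
    rw [← Real.exp_add]; ring_nf
  have e2 : Real.exp (2 / d ^ 2 * b) * Real.exp (-(2 / d ^ 2 * b)) = 1 := by
    rw [← Real.exp_add]; simp
  rw [e]
  calc _ = ((Z a).im * Real.exp (2 / d ^ 2 * a)) * Real.exp (-(2 / d ^ 2 * b)) := by ring
    _ ≤ ((Z b).im * Real.exp (2 / d ^ 2 * b)) * Real.exp (-(2 / d ^ 2 * b)) := by gcongr
    _ = _ := by rw [mul_assoc, e2, mul_one]

lemma Sol.re_right {lam : ℝ → ℝ} {Z : ℝ → ℂ} {a b : ℝ} (h : Sol lam Z a b)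
    (hZ : ∀ r ∈ Set.Icc a b, lam r < (Z a).re) : ∀ r ∈ Set.Icc a b, (Z a).re ≤ (Z r).re := by
  intro r hr
  have := image_le_of_deriv_right_lt_deriv_boundary' (f := fun r => -(Z r).re)
    (a := a) (b := b)
    (f' := fun r => -(2 * ((Z r).re - lam r) / Complex.normSq (Z r - lam r)))
    (B := fun _ => -(Z a).re) (B' := fun _ => 0)
    (fun r hr => ((h.re_deriv hr).neg).continuousAt.continuousWithinAt)
    (fun r hr => ((h.re_deriv (Set.Ico_subset_Icc_self hr)).neg).hasDerivWithinAt)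
    le_rfl continuousOn_const (fun r _ => hasDerivWithinAt_const _ _ _)
    (by
      intro x hx he
      have hx' := Set.Ico_subset_Icc_self hx
      have := (h.normSq_pos hx').2
      have h2 := hZ x hx'
      have he' : (Z x).re = (Z a).re := by simpa using he
      have : 0 < (Z x).re - lam x := by linarith
      rw [neg_lt_zero]; positivity) hr
  linarith

lemma Sol.re_left {lam : ℝ → ℝ} {Z : ℝ → ℂ} {a b : ℝ} (h : Sol lam Z a b)
    (hZ : ∀ r ∈ Set.Icc a b, (Z a).re < lam r) : ∀ r ∈ Set.Icc a b, (Z r).re ≤ (Z a).re := by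
  intro r hr
  have := image_le_of_deriv_right_lt_deriv_boundary' (f := fun r => (Z r).re)
    (a := a) (b := b)
    (f' := fun r => (2 * ((Z r).re - lam r) / Complex.normSq (Z r - lam r)))
    (B := fun _ => (Z a).re) (B' := fun _ => 0)
    (fun r hr => ((h.re_deriv hr)).continuousAt.continuousWithinAt)
    (fun r hr => ((h.re_deriv (Set.Ico_subset_Icc_self hr))).hasDerivWithinAt)
    le_rfl continuousOn_const (fun r _ => hasDerivWithinAt_const _ _ _)
    (by
      intro x hx he
      have hx' := Set.Ico_subset_Icc_self hx
      have := (h.normSq_pos hx').2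
      have h2 := hZ x hx'
      have he' : (Z x).re = (Z a).re := by simpa using he
      have : 2 * ((Z x).re - lam x) < 0 := by linarith
      exact div_neg_of_neg_of_pos this (by assumption)) hr
  simpa using this

/-- Loss of height for a point starting high above the driver. -/
lemma Sol.im_loss {lam : ℝ → ℝ} {Z : ℝ → ℂ} {a b W M q : ℝ} (h : Sol lam Z a b) (hab : a ≤ b)
    (hq : 0 < q) (hqb : b - a = q ^ 2) (hlam : ∀ r ∈ Set.Icc a b, |lam r - lam a| ≤ W)
    (hM : M = W + 4 * q) (h0 : (Z a).re = lam a) (h1 : (Z a).im = M) :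
    (Z b).im ≤ M - q ^ 2 / (2 * M) := by
  have hW : 0 ≤ W := (abs_nonneg _).trans (hlam a (Set.left_mem_Icc.2 hab))
  have hMpos : 0 < M := by linarith
  -- lower bound on im
  have him : ∀ r ∈ Set.Icc a b, M - 2 * q ≤ (Z r).im := by
    intro r hr
    have h2 := (h.mono le_rfl hr.2).im_sq hr.1
    have h3 := (h r hr).1
    rw [h1] at h2
    have hr2 := hr.2
    by_contra hc
    push Not at hc
    nlinarith
  have him2 : ∀ r ∈ Set.Icc a b, (Z r).im ≤ M := by
    intro r hr
    rw [← h1]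
    exact (h.mono le_rfl hr.2).im_anti hr.1
  have hre : ∀ r ∈ Set.Icc a b, ‖Z r - Z a‖ ≤ q := by
    intro r hr
    have := (convex_Icc a b).norm_image_sub_le_of_norm_hasDerivWithin_le (f := Z)
      (f' := fun r => 2 / (Z r - (lam r : ℂ))) (C := 1 / q)
      (fun x hx => (h x hx).2.hasDerivWithinAt) (by
        intro x hx
        have e1 := him x hx
        have e2 : (Z x).im ≤ ‖Z x - lam x‖ := by
          refine le_trans ?_ (Complex.abs_im_le_norm _)
          simpa using le_abs_self (Z x).im
        rw [norm_div]
        simp only [Complex.norm_ofNat]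
        rw [div_le_div_iff₀ (by linarith) hq]
        linarith) (Set.left_mem_Icc.2 hab) hr
    refine this.trans ?_
    rw [Real.norm_eq_abs, abs_of_nonneg (by linarith [hr.1])]
    rw [div_mul_eq_mul_div, div_le_iff₀ hq]
    nlinarith [hr.2]
  have := mono_of_deriv (F := fun r => -(Z r).im + (-(1 / (2 * M))) * r) hab
    (fun r hr => ((h.im_deriv hr).neg).add ((hasDerivAt_id r).const_mul (-(1 / (2 * M))))) (by
    intro r hr
    obtain ⟨h2, h3⟩ := h.normSq_pos hr
    have e1 := him r hr
    have e2 := him2 r hr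
    have e3 := (Complex.abs_re_le_norm _).trans (hre r hr)
    have e4 := hlam r hr
    rw [Complex.sub_re, h0] at e3
    have e5 : |(Z r).re - lam r| ≤ M := by
      calc |(Z r).re - lam r| = |((Z r).re - lam a) - (lam r - lam a)| := by ring_nf
        _ ≤ |(Z r).re - lam a| + |lam r - lam a| := abs_sub _ _
        _ ≤ M := by linarith
    have e6 : Complex.normSq (Z r - lam r) ≤ 2 * M ^ 2 := by
      rw [Complex.normSq_apply]
      have := sq_le_sq' (by linarith [(abs_le.1 e5).1]) (abs_le.1 e5).2
      simp
      nlinarith [(h r hr).1]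
    have e7 : 1 / (2 * M) ≤ 2 * (Z r).im / Complex.normSq (Z r - lam r) := by
      rw [div_le_div_iff₀ (by linarith) h3]
      nlinarith
    simp only [neg_neg, mul_one]
    linarith)
  simp only [h1] at this
  have e : q ^ 2 / (2 * M) = 1 / (2 * M) * b - 1 / (2 * M) * a := by rw [← hqb]; ring
  linarith


/-! ### Loewner chains: survival of points -/

section chain
variable {lam : ℝ → ℝ}

lemma ch_sol (ch : FwdLoewnerChain lam 1) {s : ℝ} (hs : s ∈ Set.Icc (0:ℝ) 1) {z : ℂ}
    (hz : z ∈ ch.H s) : Sol lam (fun r => ch.g r z) 0 s :=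
  ((ch.mem_H s hs z).1 hz).2.2

lemma ch_mono (ch : FwdLoewnerChain lam 1) {r s : ℝ} (hr : 0 ≤ r) (hrs : r ≤ s) (hs : s ≤ 1)
    {z : ℂ} (hz : z ∈ ch.H s) : z ∈ ch.H r := by
  have h := (ch.mem_H s ⟨hr.trans hrs, hs⟩ z).1 hz
  exact (ch.mem_H r ⟨hr, hrs.trans hs⟩ z).2
    ⟨h.1, h.2.1, fun x hx => h.2.2 x ⟨hx.1, hx.2.trans hrs⟩⟩

lemma ch_left (ch : FwdLoewnerChain lam 1) {s : ℝ} (hs : s ∈ Set.Icc (0:ℝ) 1) {z : ℂ}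
    (hz : z ∈ ch.H s) : ch.finv s (ch.g s z) = z := by
  have h1 : ch.g s z ∈ UHP := (ch.bijOn s hs).mapsTo hz
  have h2 := ch.finv_maps s hs _ h1
  exact (ch.bijOn s hs).injOn h2.1 hz h2.2

lemma field_lip {c : ℝ} (hc : 0 < c) (l : ℝ) {x y : ℂ} (hx : c ≤ x.im) (hy : c ≤ y.im) :
    ‖2 / (x - (l : ℂ)) - 2 / (y - (l : ℂ))‖ ≤ 2 / c ^ 2 * ‖x - y‖ := by
  have key : ∀ w : ℂ, c ≤ w.im → c ≤ ‖w - (l : ℂ)‖ := by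
    intro w hw
    refine le_trans ?_ (Complex.abs_im_le_norm _)
    simpa using hw.trans (le_abs_self _)
  have k1 := key x hx
  have k2 := key y hy
  have n1 : x - (l : ℂ) ≠ 0 := by
    intro h; rw [h, norm_zero] at k1; linarith
  have n2 : y - (l : ℂ) ≠ 0 := by
    intro h; rw [h, norm_zero] at k2; linarith
  have e : 2 / (x - (l : ℂ)) - 2 / (y - (l : ℂ)) =
      -2 * (x - y) / ((x - l) * (y - l)) := by
    field_simp; ring
  rw [e, norm_div, norm_mul, norm_mul]
  simp only [norm_neg, Complex.norm_ofNat]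
  rw [div_mul_eq_mul_div]
  have : c ^ 2 ≤ ‖x - (l : ℂ)‖ * ‖y - (l : ℂ)‖ := by
    rw [sq]; exact mul_le_mul k1 k2 hc.le (norm_nonneg _)
  gcongr

lemma field_norm {c : ℝ} (hc : 0 < c) (l : ℝ) {x : ℂ} (hx : c ≤ x.im) :
    ‖2 / (x - (l : ℂ))‖ ≤ 2 / c := by
  have k1 : c ≤ ‖x - (l : ℂ)‖ := by
    refine le_trans ?_ (Complex.abs_im_le_norm _)
    simpa using hx.trans (le_abs_self _)
  rw [norm_div]
  simp only [Complex.norm_ofNat]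
  gcongr

/-- Picard-Lindelöf, with control of the range of the solution -/
lemma picard_mem {f : ℝ → ℂ → ℂ} {tmin tmax : ℝ} {t₀ : Set.Icc tmin tmax} {x₀ : ℂ}
    {a L K : NNReal} (hP : IsPicardLindelof f t₀ x₀ a 0 L K) :
    ∃ α : ℝ → ℂ, α t₀ = x₀ ∧ ∀ r ∈ Set.Icc tmin tmax, α r ∈ Metric.closedBall x₀ a ∧
      HasDerivWithinAt α (f r (α r)) (Set.Icc tmin tmax) r := by
  have hx : x₀ ∈ Metric.closedBall x₀ ((0 : NNReal) : ℝ) := by simp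
  obtain ⟨α, hα⟩ := ODE.FunSpace.exists_isFixedPt_next hP hx
  refine ⟨α.compProj, ?_, fun t ht ↦ ⟨?_, ?_⟩⟩
  · rw [ODE.FunSpace.compProj_val, ← hα, ODE.FunSpace.next_apply₀]
  · exact α.compProj_mem_closedBall hP.mul_max_le
  · apply ODE.hasDerivWithinAt_picard_Icc t₀.2 hP.continuousOn_uncurry
      α.continuous_compProj.continuousOn (fun _ ht' ↦ α.compProj_mem_closedBall hP.mul_max_le)
      x₀ ht |>.congr_of_mem _ ht
    intro t' ht'
    nth_rw 1 [← hα]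
    rw [ODE.FunSpace.compProj_of_mem ht', ODE.FunSpace.next_apply]

/-- local existence for the Loewner ODE -/
lemma local_exist {u s c : ℝ} (hlam : ContinuousOn lam (Set.Icc u s)) (hus : u ≤ s)
    (hc : 0 < c) (hsc : s - u ≤ c ^ 2 / 8) (w : ℂ) (hw : c ≤ w.im) :
    ∃ α : ℝ → ℂ, α u = w ∧ ∀ r ∈ Set.Icc u s, c / 2 ≤ (α r).im ∧
      HasDerivWithinAt α (2 / (α r - (lam r : ℂ))) (Set.Icc u s) r := by
  have hball : ∀ x ∈ Metric.closedBall w (c / 2), c / 2 ≤ x.im := by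
    intro x hx
    rw [mem_closedBall_iff_norm] at hx
    have := (Complex.abs_im_le_norm _).trans hx
    rw [Complex.sub_im, abs_le] at this
    linarith [this.1]
  have hc2 : 0 < c / 2 := by linarith
  have hP : IsPicardLindelof (fun (r : ℝ) (x : ℂ) => 2 / (x - (lam r : ℂ)))
      (⟨u, Set.left_mem_Icc.2 hus⟩ : Set.Icc u s) w ⟨c / 2, hc2.le⟩ 0
      ⟨2 / (c / 2), by positivity⟩ ⟨2 / (c / 2) ^ 2, by positivity⟩ := by
    refine ⟨?_, ?_, ?_, ?_⟩
    · intro t _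
      refine LipschitzOnWith.of_dist_le_mul fun x hx y hy => ?_
      rw [dist_eq_norm, dist_eq_norm]
      exact field_lip hc2 _ (hball x hx) (hball y hy)
    · intro x hx
      refine ContinuousOn.div continuousOn_const
        (continuousOn_const.sub (Complex.continuous_ofReal.comp_continuousOn hlam)) ?_
      intro t _ h
      have := hball x hx
      have h2 := congrArg Complex.im h
      simp at h2
      linarith
    · intro t _ x hx
      exact field_norm hc2 _ (hball x hx)
    · show 2 / (c / 2) * max (s - u) (u - u) ≤ c / 2 - 0
      rw [max_eq_left (by linarith), sub_zero, div_mul_eq_mul_div, div_le_iff₀ hc2]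
      nlinarith
  obtain ⟨α, h0, h1⟩ := picard_mem hP
  exact ⟨α, h0, fun r hr => ⟨hball _ (h1 r hr).1, (h1 r hr).2⟩⟩

lemma ch_step (ch : FwdLoewnerChain lam 1) (hlam : ContinuousOn lam (Set.Icc 0 1))
    {u s c : ℝ} (hu : 0 ≤ u) (hus : u ≤ s) (hs : s ≤ 1)
    (hc : 0 < c) (hsc : s - u ≤ c ^ 2 / 8) {z : ℂ} (hz : z ∈ ch.H u) (hzc : c ≤ (ch.g u z).im) :
    z ∈ ch.H s := by
  obtain ⟨α, hα0, hα⟩ := local_exist (hlam.mono (Set.Icc_subset_Icc hu hs)) hus hc hsc _ hzc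
  have hc2 : 0 < c / 2 := by linarith
  have hsI : s ∈ Set.Icc (0:ℝ) 1 := ⟨hu.trans hus, hs⟩
  have hαs := (hα s (Set.right_mem_Icc.2 hus)).1
  obtain ⟨hz', hgz'⟩ := ch.finv_maps s hsI (α s) (lt_of_lt_of_le hc2 hαs)
  set z' := ch.finv s (α s) with hz'def
  have hsol := (ch_sol ch hsI hz').mono hu le_rfl
  have hY : ∀ r ∈ Set.Icc u s, c / 2 ≤ (ch.g r z').im := by
    intro r hr
    have := (hsol.mono hr.1 le_rfl).im_anti hr.2
    simp only [hgz'] at this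
    linarith
  have huniq := ODE_solution_unique_of_mem_Icc_left (a := u) (b := s)
    (v := fun r x => 2 / (x - (lam r : ℂ))) (s := fun _ => {x : ℂ | c / 2 ≤ x.im})
    (K := ⟨2 / (c / 2) ^ 2, by positivity⟩) (f := α) (g := fun r => ch.g r z')
    (by
      intro t _
      refine LipschitzOnWith.of_dist_le_mul fun x hx y hy => ?_
      rw [dist_eq_norm, dist_eq_norm]
      exact field_lip hc2 _ hx hy)
    (fun r hr => (hα r hr).2.continuousWithinAt)
    (fun r hr => (hα r (Set.Ioc_subset_Icc_self hr)).2.mono_of_mem_nhdsWithin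
      (Icc_mem_nhdsLE_of_mem hr))
    (fun r hr => (hα r (Set.Ioc_subset_Icc_self hr)).1)
    hsol.cont
    (fun r hr => (hsol r (Set.Ioc_subset_Icc_self hr)).2.hasDerivWithinAt)
    (fun r hr => hY r (Set.Ioc_subset_Icc_self hr))
    hgz'.symm
  have h1 := huniq (Set.left_mem_Icc.2 hus)
  simp only [hα0] at h1
  have : z = z' := (ch.bijOn u ⟨hu, hus.trans hs⟩).injOn hz (ch_mono ch hu hus hs hz') h1
  rw [this]; exact hz'

/-- A set of points, whose heights stay bounded below as long as they all survive, survives. -/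
lemma ch_survive (ch : FwdLoewnerChain lam 1) (hlam : ContinuousOn lam (Set.Icc 0 1))
    {t T c : ℝ} (ht : 0 ≤ t) (htT : t ≤ T) (hT : T ≤ 1) (hc : 0 < c) (J : Set ℂ)
    (hJ : J ⊆ ch.H t)
    (h : ∀ s ∈ Set.Icc t T, J ⊆ ch.H s → ∀ z ∈ J, c ≤ (ch.g s z).im) : J ⊆ ch.H T := by
  have key : ∀ k : ℕ, J ⊆ ch.H (min (t + k * (c ^ 2 / 8)) T) := by
    intro k
    induction k with
    | zero => simpa [htT] using hJ
    | succ k ih =>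
      intro z hz
      have hm : min (t + k * (c ^ 2 / 8)) T ∈ Set.Icc t T :=
        ⟨le_min (by linarith [show (0:ℝ) ≤ k * (c ^ 2 / 8) by positivity]) htT, min_le_right _ _⟩
      refine ch_step ch hlam (u := min (t + k * (c ^ 2 / 8)) T) (ht.trans hm.1) ?_
        ((min_le_right _ _).trans hT) hc ?_ (ih hz) (h _ hm ih z hz)
      · apply min_le_min_right
        push_cast; nlinarith [sq_nonneg c]
      · push_cast
        rcases le_total (t + k * (c ^ 2 / 8)) T with h1 | h1
        · rw [min_eq_left h1]
          linarith [min_le_left (t + (k + 1) * (c ^ 2 / 8)) T]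
        · rw [min_eq_right h1]
          linarith [min_le_right (t + (k + 1) * (c ^ 2 / 8)) T, sq_nonneg c]
  obtain ⟨k, hk⟩ := exists_nat_ge ((T - t) / (c ^ 2 / 8))
  have := key k
  rw [div_le_iff₀ (by positivity)] at hk
  rwa [min_eq_right (by linarith)] at this

end chain


/-! ### Existence of a swallowed point at a definite height -/

section swallow
variable {lam : ℝ → ℝ}

lemma high_survive (ch : FwdLoewnerChain lam 1) (hlam : ContinuousOn lam (Set.Icc 0 1))
    {t T c : ℝ} (ht : 0 ≤ t) (htT : t ≤ T) (hT : T ≤ 1) (hc : 0 < c) {z : ℂ}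
    (hz : z ∈ ch.H t) (hzc : c ^ 2 ≤ (ch.g t z).im ^ 2 - 4 * (T - t)) :
    ∀ s ∈ Set.Icc t T, z ∈ ch.H s ∧ c ≤ (ch.g s z).im := by
  have key : ∀ s ∈ Set.Icc t T, z ∈ ch.H s → c ≤ (ch.g s z).im := by
    intro s hs hzs
    have hsol := (ch_sol ch ⟨ht.trans hs.1, hs.2.trans hT⟩ hzs).mono ht le_rfl
    have h1 := hsol.im_sq hs.1
    have h2 := (hsol s (Set.right_mem_Icc.2 hs.1)).1
    have h3 := hs.2
    simp only at h1 h2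
    by_contra hcon
    push Not at hcon
    nlinarith
  have hzT : z ∈ ch.H T := by
    have := ch_survive ch hlam ht htT hT hc {z} (by simpa using hz)
      (by
        intro s hs hJ x hx
        rw [Set.mem_singleton_iff.1 hx]
        exact key s hs (by simpa using hJ))
    simpa using this
  intro s hs
  have := ch_mono ch (ht.trans hs.1) hs.2 hT hzT
  exact ⟨this, key s hs this⟩

/-- Lower height bound from lower bound on the distance to the driver. -/
lemma far_im (ch : FwdLoewnerChain lam 1)
    {t T s d : ℝ} (ht : 0 ≤ t) (hs : s ∈ Set.Icc t T) (hT : T ≤ 1) (hd : 0 < d) {z : ℂ}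
    (hz : z ∈ ch.H s) (h : ∀ r ∈ Set.Icc t s, d ≤ ‖ch.g r z - lam r‖) :
    (ch.g t z).im * Real.exp (-(2 / d ^ 2 * (T - t))) ≤ (ch.g s z).im := by
  have hsol := (ch_sol ch ⟨ht.trans hs.1, hs.2.trans hT⟩ hz).mono ht le_rfl
  refine le_trans ?_ (hsol.im_exp hs.1 hd h)
  have h1 := (hsol t (Set.left_mem_Icc.2 hs.1)).1
  have h3 := hs.2
  simp only at h1
  gcongr

lemma re_survive (ch : FwdLoewnerChain lam 1) (hlam : ContinuousOn lam (Set.Icc 0 1))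
    {t T W : ℝ} (ht : 0 ≤ t) (htT : t ≤ T) (hT : T ≤ 1)
    (hW : ∀ r ∈ Set.Icc t T, |lam r - lam t| ≤ W) {z : ℂ}
    (hz : z ∈ ch.H t) (hzW : W < |(ch.g t z).re - lam t|) : z ∈ ch.H T := by
  have h0 : 0 < (ch.g t z).im := (ch_sol ch ⟨ht, htT.trans hT⟩ hz t ⟨ht, le_rfl⟩).1
  set d := |(ch.g t z).re - lam t| - W with hd
  have hdpos : 0 < d := by linarith
  have key : ∀ s ∈ Set.Icc t T, z ∈ ch.H s → ∀ r ∈ Set.Icc t s, d ≤ ‖ch.g r z - lam r‖ := by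
    intro s hs hzs r hr
    have hsol := (ch_sol ch ⟨ht.trans hs.1, hs.2.trans hT⟩ hzs).mono ht le_rfl
    refine le_trans ?_ (Complex.abs_re_le_norm _)
    have hr' := abs_le.1 (hW r ⟨hr.1, hr.2.trans hs.2⟩)
    simp only [Complex.sub_re, Complex.ofReal_re]
    rcases le_total 0 ((ch.g t z).re - lam t) with hp | hp
    · rw [abs_of_nonneg hp] at hd
      have := hsol.re_right (by
        intro x hx
        have := (abs_le.1 (hW x ⟨hx.1, hx.2.trans hs.2⟩)).2
        linarith) r hr
      refine le_trans ?_ (le_abs_self _)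
      linarith
    · rw [abs_of_nonpos hp] at hd
      have := hsol.re_left (by
        intro x hx
        have := (abs_le.1 (hW x ⟨hx.1, hx.2.trans hs.2⟩)).1
        linarith) r hr
      refine le_trans ?_ (neg_le_abs _)
      linarith
  have := ch_survive ch hlam ht htT hT
    (c := (ch.g t z).im * Real.exp (-(2 / d ^ 2 * (T - t)))) (by positivity) {z}
    (by simpa using hz)
    (by
      intro s hs hJ x hx
      rw [Set.mem_singleton_iff.1 hx]
      have hzs : z ∈ ch.H s := by simpa using hJ
      exact far_im ch ht hs hT hdpos hzs (key s hs hzs))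
  simpa using this

lemma exists_swallowed (ch : FwdLoewnerChain lam 1)
    {t T W M q : ℝ} (ht : 0 ≤ t) (htT : t ≤ T) (hT : T ≤ 1)
    (hW : ∀ r ∈ Set.Icc t T, |lam r - lam t| ≤ W) (hq : 0 < q) (hqT : T - t = q ^ 2)
    (hM : M = W + 4 * q) :
    ∃ w : ℂ, q ^ 2 / (4 * M) ≤ w.im ∧ ch.finv t w ∉ ch.H T := by
  by_contra hcon
  push Not at hcon
  have hW0 : 0 ≤ W := (abs_nonneg _).trans (hW t (Set.left_mem_Icc.2 htT))
  have hM0 : 0 < M := by linarith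
  set η := q ^ 2 / (4 * M) with hη
  have hη0 : 0 < η := by positivity
  have htI : t ∈ Set.Icc (0:ℝ) 1 := ⟨ht, htT.trans hT⟩
  have hTI : T ∈ Set.Icc (0:ℝ) 1 := ⟨ht.trans htT, hT⟩
  have hfl : ∀ w : ℂ, η ≤ w.im → Sol lam (fun r => ch.g r (ch.finv t w)) t T ∧
      ch.g t (ch.finv t w) = w := fun w hw =>
    ⟨(ch_sol ch hTI (hcon w hw)).mono ht le_rfl, (ch.finv_maps t htI w (hη0.trans_le hw)).2⟩
  let wf : ℂ → ℂ := fun ζ => (lam t : ℂ) + Complex.I * (ζ + η)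
  have hwim : ∀ ζ, (wf ζ).im = ζ.re + η := by intro ζ; simp [wf]
  let h : ℂ → ℂ := fun w => ch.g T (ch.finv t w)
  let Φ : ℂ → ℂ := fun ζ => Complex.exp (-Complex.I * (wf ζ - h (wf ζ)))
  have hΦn : ∀ ζ, ‖Φ ζ‖ = Real.exp ((wf ζ).im - (h (wf ζ)).im) := by
    intro ζ
    simp only [Φ, Complex.norm_exp]
    simp
  have hhd : DifferentiableOn ℂ h {w | η ≤ w.im} := by
    refine (ch.g_holo T hTI).comp ((ch.finv_holo t htI).mono ?_) ?_
    · intro w hw; exact lt_of_lt_of_le hη0 hw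
    · intro w hw; exact hcon w hw
  have hwd : Differentiable ℂ wf := by
    intro ζ; simp only [wf]; fun_prop
  have hΦd : DifferentiableOn ℂ Φ {ζ | 0 ≤ ζ.re} := by
    have h1 : DifferentiableOn ℂ (fun ζ => h (wf ζ)) {ζ | 0 ≤ ζ.re} := by
      refine hhd.comp hwd.differentiableOn ?_
      intro ζ hζ
      have hζ' : 0 ≤ ζ.re := hζ
      show η ≤ (wf ζ).im
      rw [hwim]; linarith
    exact ((hwd.differentiableOn.sub h1).const_mul _).cexp
  have hDC : DiffContOnCl ℂ Φ {ζ | 0 < ζ.re} := by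
    refine ⟨hΦd.mono (fun ζ (hζ : 0 < ζ.re) => (le_of_lt hζ : 0 ≤ ζ.re)), ?_⟩
    rw [Complex.closure_setOf_lt_re]
    exact hΦd.continuousOn
  have hbd : ∀ ζ : ℂ, 0 ≤ ζ.re → ‖Φ ζ‖ ≤ Real.exp (2 * q) := by
    intro ζ hζ
    rw [hΦn]
    apply Real.exp_le_exp.2
    have hw : η ≤ (wf ζ).im := by rw [hwim]; linarith
    obtain ⟨hs, he⟩ := hfl _ hw
    have h1 := hs.im_sq htT
    have h2 := (hs T (Set.right_mem_Icc.2 htT)).1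
    simp only [he] at h1 h2
    rw [hqT] at h1
    show (wf ζ).im - (ch.g T (ch.finv t (wf ζ))).im ≤ 2 * q
    by_contra hc
    push Not at hc
    nlinarith
  have hbdim : ∀ x : ℝ, ‖Φ (x * Complex.I)‖ ≤ Real.exp η := by
    intro x
    rw [hΦn]
    apply Real.exp_le_exp.2
    have hw : (wf (x * Complex.I)).im = η := by rw [hwim]; simp
    obtain ⟨hs, he⟩ := hfl _ hw.ge
    have h2 := (hs T (Set.right_mem_Icc.2 htT)).1
    simp only at h2
    show (wf (x * Complex.I)).im - (ch.g T (ch.finv t (wf (x * Complex.I)))).im ≤ η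
    linarith
  have hPL := PhragmenLindelof.right_half_plane_of_bounded_on_real hDC
    (C := Real.exp η) (z := ((M - η : ℝ) : ℂ))
    ⟨1, by norm_num, 0, by
      refine Asymptotics.IsBigO.of_bound (Real.exp (2 * q)) ?_
      refine Filter.mem_inf_of_right ?_
      rw [Filter.mem_principal]
      intro ζ hζ
      simpa using hbd ζ (le_of_lt hζ)⟩
    (by
      refine ⟨Real.exp (2 * q), ?_⟩
      rw [Filter.eventually_map]
      filter_upwards [Filter.eventually_ge_atTop (0:ℝ)] with x hx
      exact hbd _ (by simpa using hx))
    hbdim (by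
      have : η ≤ M := by
        rw [hη, div_le_iff₀ (by positivity)]
        nlinarith
      simpa using this)
  rw [hΦn] at hPL
  have hPL := Real.exp_le_exp.1 hPL
  have hwM : wf ((M - η : ℝ) : ℂ) = (lam t : ℂ) + Complex.I * M := by simp [wf]
  have hwMim : (wf ((M - η : ℝ) : ℂ)).im = M := by rw [hwM]; simp
  have hwMre : (wf ((M - η : ℝ) : ℂ)).re = lam t := by rw [hwM]; simp
  have hηM : η ≤ M := by
    rw [hη, div_le_iff₀ (by positivity)]
    nlinarith
  obtain ⟨hs, he⟩ := hfl (wf ((M - η : ℝ) : ℂ)) (by rw [hwMim]; exact hηM)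
  have := hs.im_loss htT hq hqT hW hM (by simp only [he, hwMre]) (by simp only [he, hwMim])
  rw [hwMim] at hPL
  have e : q ^ 2 / (2 * M) = 2 * η := by rw [hη]; field_simp; norm_num
  simp only [h] at hPL
  linarith

end swallow

/-! ### Length-area estimate -/

section lengtharea

def strip : Set ℂ := {ζ | ζ.re < 0 ∧ 0 < ζ.im ∧ ζ.im < Real.pi}

lemma strip_open : IsOpen strip := by
  unfold strip
  exact (isOpen_lt Complex.continuous_re continuous_const).inter
    ((isOpen_lt continuous_const Complex.continuous_im).inter
      (isOpen_lt Complex.continuous_im continuous_const))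

lemma area_le {Q : ℂ → ℂ} (hd : DifferentiableOn ℂ Q strip) (hi : Set.InjOn Q strip) {A : ENNReal}
    (hA : volume (Q '' strip) ≤ A) {N : ℝ} (hN : 0 < N) :
    ∫⁻ x in Set.Ioo (-2 * N) (-N), ∫⁻ y in Set.Ioo 0 Real.pi,
      ENNReal.ofReal (‖deriv Q (x + y * Complex.I)‖ ^ 2) ≤ A := by
  have h1 : ∀ ζ ∈ strip, HasFDerivWithinAt Q
      ((ContinuousLinearMap.toSpanSingleton ℂ (deriv Q ζ)).restrictScalars ℝ) strip ζ := by
    intro ζ hζ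
    have := ((hd ζ hζ).differentiableAt (strip_open.mem_nhds hζ)).hasDerivAt
    exact (this.hasFDerivAt.restrictScalars ℝ).hasFDerivWithinAt
  have h2 := lintegral_abs_det_fderiv_eq_addHaar_image volume strip_open.measurableSet h1 hi
  have hdet : ∀ a : ℂ, ENNReal.ofReal |((ContinuousLinearMap.toSpanSingleton ℂ a).restrictScalars
      ℝ).det| = ENNReal.ofReal (‖a‖ ^ 2) := by
    intro a
    congr 1
    simp [ContinuousLinearMap.det, LinearMap.det_restrictScalars, Algebra.norm_complex_eq,
      Complex.normSq_eq_norm_sq]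
  simp only [hdet] at h2
  have hm : Measurable fun ζ : ℂ => ENNReal.ofReal (‖deriv Q ζ‖ ^ 2) :=
    (((measurable_deriv Q).norm).pow_const 2).ennreal_ofReal
  have hmp := Complex.volume_preserving_equiv_real_prod.symm
  set B : Set (ℝ × ℝ) := Set.Ioo (-2 * N) (-N) ×ˢ Set.Ioo 0 Real.pi with hB
  have hsub : Complex.measurableEquivRealProd ⁻¹' B ⊆ strip := by
    intro ζ hζ
    simp only [hB, Set.mem_preimage, Set.mem_prod, Complex.measurableEquivRealProd_apply,
      Set.mem_Ioo] at hζ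
    exact ⟨by linarith [hζ.1.2], hζ.2.1, hζ.2.2⟩
  have h3 : ∫⁻ ζ in Complex.measurableEquivRealProd ⁻¹' B, ENNReal.ofReal (‖deriv Q ζ‖ ^ 2) ≤ A :=
    (lintegral_mono_set hsub).trans (h2.le.trans hA)
  have h4 := Complex.volume_preserving_equiv_real_prod.setLIntegral_comp_preimage_emb
    Complex.measurableEquivRealProd.measurableEmbedding
    (fun p : ℝ × ℝ => ENNReal.ofReal (‖deriv Q (p.1 + p.2 * Complex.I)‖ ^ 2)) B
  simp only [Complex.measurableEquivRealProd_apply, Complex.re_add_im] at h4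
  rw [h4] at h3
  have hm2 : Measurable (fun p : ℝ × ℝ =>
      ENNReal.ofReal (‖deriv Q (p.1 + p.2 * Complex.I)‖ ^ 2)) := by
    refine hm.comp (Measurable.add ?_ (Measurable.mul ?_ ?_)) <;> fun_prop
  rw [hB, Measure.volume_eq_prod, setLIntegral_prod _ hm2.aemeasurable] at h3
  exact h3

lemma length_area {Q : ℂ → ℂ} (hd : DifferentiableOn ℂ Q strip) (hi : Set.InjOn Q strip) {A : ℝ}
    (hA0 : 0 ≤ A) (hA : volume (Q '' strip) ≤ ENNReal.ofReal A) {N ε : ℝ} (hN : 0 < N)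
    (hε : 0 < ε) (hNε : 4 * (A + 1) ≤ ε ^ 2 * N) :
    ∃ x ∈ Set.Ioo (-2 * N) (-N), ∀ a ∈ Set.Ioo 0 Real.pi, ∀ b ∈ Set.Ioo 0 Real.pi,
      ‖Q (x + b * Complex.I) - Q (x + a * Complex.I)‖ ≤ ε := by
  have h1 := area_le hd hi hA hN
  obtain ⟨x, hx, hxI⟩ : ∃ x ∈ Set.Ioo (-2 * N) (-N), ∫⁻ y in Set.Ioo 0 Real.pi,
      ENNReal.ofReal (‖deriv Q (x + y * Complex.I)‖ ^ 2) ≤ ENNReal.ofReal ((A + 1) / N) := by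
    by_contra hcon
    push Not at hcon
    have h2 : ∫⁻ x in Set.Ioo (-2 * N) (-N), ENNReal.ofReal ((A + 1) / N) ≤ ENNReal.ofReal A := by
      refine le_trans ?_ h1
      exact setLIntegral_mono' measurableSet_Ioo fun x hx => (hcon x hx).le
    rw [setLIntegral_const, Real.volume_Ioo, ← ENNReal.ofReal_mul (by positivity),
      ENNReal.ofReal_le_ofReal_iff hA0] at h2
    have : (A + 1) / N * (-N - -2 * N) = A + 1 := by field_simp; ring
    linarith
  refine ⟨x, hx, ?_⟩
  have key : ∀ a ∈ Set.Ioo 0 Real.pi, ∀ b ∈ Set.Ioo 0 Real.pi, a ≤ b →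
      ‖Q (x + b * Complex.I) - Q (x + a * Complex.I)‖ ≤ ε := by
    intro a ha b hb hab
    have hmem : ∀ y ∈ Set.Icc a b, (x + y * Complex.I : ℂ) ∈ strip := by
      intro y hy
      refine ⟨?_, ?_, ?_⟩
      · simpa using by linarith [hx.2]
      · simpa using ha.1.trans_le hy.1
      · simpa using hy.2.trans_lt hb.2
    have hder : ∀ y ∈ Set.uIcc a b, HasDerivAt (fun y : ℝ => Q (x + y * Complex.I))
        (deriv Q (x + y * Complex.I) * Complex.I) y := by
      intro y hy
      rw [Set.uIcc_of_le hab] at hy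
      have h := ((hd _ (hmem y hy)).differentiableAt (strip_open.mem_nhds (hmem y hy))).hasDerivAt
      have h' : HasDerivAt (fun y : ℝ => (x + y * Complex.I : ℂ)) Complex.I y := by
        simpa using ((Complex.ofRealCLM.hasDerivAt (x := y)).mul_const Complex.I).const_add (x : ℂ)
      exact HasDerivAt.comp y h h'
    have hc : ContinuousOn (fun y : ℝ => deriv Q (x + y * Complex.I)) (Set.Icc a b) := by
      refine (hd.deriv strip_open).continuousOn.comp (Continuous.continuousOn (by fun_prop)) hmem
    have hc' : ContinuousOn (fun y : ℝ => deriv Q (x + y * Complex.I)) (Set.uIcc a b) := by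
      rwa [Set.uIcc_of_le hab]
    have hF := intervalIntegral.integral_eq_sub_of_hasDerivAt hder
      (hc'.mul continuousOn_const).intervalIntegrable
    rw [← hF]
    set κ := ε / 4 with hκ
    have hκ0 : 0 < κ := by positivity
    have hsq : IntervalIntegrable (fun y : ℝ => ‖deriv Q (x + y * Complex.I)‖ ^ 2) volume a b :=
      (hc'.norm.pow 2).intervalIntegrable
    have hI0 : ∫ y in a..b, ‖deriv Q (x + y * Complex.I)‖ ^ 2 ≤ (A + 1) / N := by
      rw [intervalIntegral.integral_of_le hab]
      have h5 := ofReal_integral_eq_lintegral_ofReal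
        (μ := volume.restrict (Set.Ioc a b)) hsq.1 (Filter.Eventually.of_forall fun y => by positivity)
      rw [← ENNReal.ofReal_le_ofReal_iff (by positivity), h5]
      refine le_trans (lintegral_mono_set ?_) hxI
      intro y hy
      exact ⟨ha.1.trans hy.1, hy.2.trans_lt hb.2⟩
    calc ‖∫ y in a..b, deriv Q (x + y * Complex.I) * Complex.I‖
        ≤ ∫ y in a..b, (κ / 2 + (1 / (2 * κ)) * ‖deriv Q (x + y * Complex.I)‖ ^ 2) := by
          refine intervalIntegral.norm_integral_le_of_norm_le hab
            (Filter.Eventually.of_forall fun y hy => ?_)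
            ((continuous_const.intervalIntegrable a b).add (hsq.const_mul _))
          rw [norm_mul, Complex.norm_I, mul_one]
          set v := ‖deriv Q (x + y * Complex.I)‖
          have : κ / 2 + (1 / (2 * κ)) * v ^ 2 - v = (v - κ) ^ 2 / (2 * κ) := by field_simp; ring
          have : 0 ≤ (v - κ) ^ 2 / (2 * κ) := by positivity
          linarith
      _ = (b - a) * (κ / 2) + (1 / (2 * κ)) *
            ∫ y in a..b, ‖deriv Q (x + y * Complex.I)‖ ^ 2 := by
          rw [intervalIntegral.integral_add (continuous_const.intervalIntegrable a b)
            (hsq.const_mul _), intervalIntegral.integral_const, intervalIntegral.integral_const_mul,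
            smul_eq_mul]
      _ ≤ 4 * (κ / 2) + (1 / (2 * κ)) * ((A + 1) / N) := by
          gcongr
          linarith [ha.1, hb.2, Real.pi_le_four]
      _ ≤ ε := by
          have : (1 / (2 * κ)) * ((A + 1) / N) ≤ ε / 2 := by
            rw [hκ]
            have : 1 / (2 * (ε / 4)) * ((A + 1) / N) = 2 * (A + 1) / (ε * N) := by
              field_simp; norm_num
            rw [this, div_le_iff₀ (by positivity)]
            nlinarith
          rw [hκ] at this ⊢
          linarith
  intro a ha b hb
  rcases le_total a b with h | h
  · exact key a ha b hb h
  · rw [norm_sub_rev]; exact key b hb a ha h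

end lengtharea

/-! ### Small arcs and uniform convergence to the trace -/

section arcs
variable {lam : ℝ → ℝ}

lemma finv_bdd (ch : FwdLoewnerChain lam 1) {Λ : ℝ} (hΛ : ∀ r ∈ Set.Icc (0:ℝ) 1, |lam r| ≤ Λ)
    {u : ℝ} (hu : u ∈ Set.Icc (0:ℝ) 1) {w : ℂ} (hw : w ∈ UHP) (hw1 : ‖w - lam u‖ < 1) :
    ch.finv u w ∈ Metric.closedBall (0:ℂ) (Λ + 4) := by
  obtain ⟨h1, h2⟩ := ch.finv_maps u hu w hw
  set z := ch.finv u w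
  have h3 := (ch.mem_H u hu z).1 h1
  have h0 : ch.g 0 z = z := h3.2.1
  have hs : Sol lam (fun r => ch.g r z) 0 u := ch_sol ch hu h1
  have hre : |w.re - lam u| < 1 := by
    have := (Complex.abs_re_le_norm (w - lam u)).trans_lt hw1
    simpa using this
  have him : |w.im| < 1 := by
    have := (Complex.abs_im_le_norm (w - lam u)).trans_lt hw1
    simpa using this
  have him2 := hs.im_sq hu.1
  simp only [h0, h2] at him2
  have hz0 : 0 < z.im := h3.1
  have hzi : |z.im| ≤ 3 := by
    rw [abs_of_pos hz0]
    have := abs_lt.1 him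
    have := hu.2
    nlinarith
  have hl := abs_le.1 (hΛ u hu)
  have hre' := abs_lt.1 hre
  have hzr : |z.re| ≤ Λ + 1 := by
    rw [abs_le]
    constructor
    · by_contra hc
      push Not at hc
      have := hs.re_left (by
        intro r hr
        have := abs_le.1 (hΛ r ⟨hr.1, hr.2.trans hu.2⟩)
        simp only [h0]; linarith) u (Set.right_mem_Icc.2 hu.1)
      simp only [h0, h2] at this
      linarith
    · by_contra hc
      push Not at hc
      have := hs.re_right (by
        intro r hr
        have := abs_le.1 (hΛ r ⟨hr.1, hr.2.trans hu.2⟩)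
        simp only [h0]; linarith) u (Set.right_mem_Icc.2 hu.1)
      simp only [h0, h2] at this
      linarith
  rw [mem_closedBall_zero_iff]
  have := Complex.norm_le_abs_re_add_abs_im z
  linarith

lemma log_mem {v : ℂ} (hv : 0 < v.im) : (Complex.log v).im ∈ Set.Ioo 0 Real.pi := by
  rw [Complex.log_im]
  have h1 : 0 < ‖v‖ := norm_pos_iff.2 (by rintro rfl; simp at hv)
  have h2 := Complex.norm_mul_sin_arg v
  have h3 : 0 < Real.sin v.arg := by
    by_contra hc
    push Not at hc
    nlinarith
  constructor
  · by_contra hc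
    push Not at hc
    have := Real.sin_nonpos_of_nonpos_of_neg_pi_le hc (Complex.neg_pi_lt_arg v).le
    linarith
  · refine lt_of_le_of_ne (Complex.arg_le_pi v) ?_
    intro he
    rw [he] at h3
    simp at h3

lemma small_arc (ch : FwdLoewnerChain lam 1) (hlam : ContinuousOn lam (Set.Icc 0 1)) {ε : ℝ}
    (hε : 0 < ε) : ∃ N₀ : ℝ, ∀ N : ℝ, N₀ ≤ N → 0 < N → ∀ u ∈ Set.Icc (0:ℝ) 1,
      ∃ ρ ∈ Set.Ioo (Real.exp (-2 * N)) (Real.exp (-N)), ∀ w₁ ∈ UHP, ∀ w₂ ∈ UHP,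
        ‖w₁ - lam u‖ = ρ → ‖w₂ - lam u‖ = ρ → ‖ch.finv u w₁ - ch.finv u w₂‖ ≤ ε := by
  obtain ⟨Λ, hΛ⟩ := isCompact_Icc.exists_bound_of_continuousOn hlam
  simp only [Real.norm_eq_abs] at hΛ
  set A := (volume (Metric.closedBall (0:ℂ) (Λ + 4))).toReal with hA
  have hA0 : 0 ≤ A := ENNReal.toReal_nonneg
  refine ⟨4 * (A + 1) / ε ^ 2, fun N hN hN0 u hu => ?_⟩
  let Q : ℂ → ℂ := fun ζ => ch.finv u (lam u + Complex.exp ζ)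
  have hmem : ∀ ζ ∈ strip, (lam u + Complex.exp ζ : ℂ) ∈ UHP := by
    intro ζ hζ
    show 0 < (lam u + Complex.exp ζ : ℂ).im
    simp only [Complex.add_im, Complex.ofReal_im, Complex.exp_im, zero_add]
    exact mul_pos (Real.exp_pos _) (Real.sin_pos_of_pos_of_lt_pi hζ.2.1 hζ.2.2)
  have hd : DifferentiableOn ℂ Q strip := by
    refine (ch.finv_holo u hu).comp (Differentiable.differentiableOn (by fun_prop)) hmem
  have hi : Set.InjOn Q strip := by
    intro a ha b hb hab
    have h1 := (ch.finv_maps u hu _ (hmem a ha)).2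
    have h2 := (ch.finv_maps u hu _ (hmem b hb)).2
    have h3 : ch.finv u (lam u + Complex.exp a) = ch.finv u (lam u + Complex.exp b) := hab
    rw [h3, h2] at h1
    have h4 : Complex.exp b = Complex.exp a := by simpa using h1
    have hp := Real.pi_pos
    have e1 := Complex.log_exp (x := a) (by linarith [ha.2.1]) (by linarith [ha.2.2])
    have e2 := Complex.log_exp (x := b) (by linarith [hb.2.1]) (by linarith [hb.2.2])
    rw [← e1, ← e2, h4]
  have hvol : volume (Q '' strip) ≤ ENNReal.ofReal A := by
    rw [hA, ENNReal.ofReal_toReal measure_closedBall_lt_top.ne]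
    refine measure_mono ?_
    rintro _ ⟨ζ, hζ, rfl⟩
    refine finv_bdd ch hΛ hu (hmem ζ hζ) ?_
    rw [add_sub_cancel_left, Complex.norm_exp, Real.exp_lt_one_iff]
    exact hζ.1
  obtain ⟨x, hx, hxQ⟩ := length_area hd hi hA0 hvol hN0 hε (by
    rw [div_le_iff₀ (by positivity)] at hN; linarith)
  refine ⟨Real.exp x, ⟨Real.exp_lt_exp.2 hx.1, Real.exp_lt_exp.2 hx.2⟩, ?_⟩
  have hpol : ∀ w ∈ UHP, ‖w - lam u‖ = Real.exp x → ∃ b ∈ Set.Ioo 0 Real.pi,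
      ch.finv u w = Q (x + b * Complex.I) := by
    intro w hw hwx
    have hv : 0 < (w - lam u).im := by
      have : 0 < w.im := hw
      simpa using this
    have hv0 : w - lam u ≠ 0 := by
      intro h; rw [h] at hv; simp at hv
    refine ⟨(Complex.log (w - lam u)).im, log_mem hv, ?_⟩
    have : (x : ℂ) = (((Complex.log (w - lam u)).re : ℝ) : ℂ) := by
      rw [Complex.log_re, hwx, Real.log_exp]
    simp only [Q]
    rw [this, Complex.re_add_im, Complex.exp_log hv0]
    congr 1
    ring
  intro w₁ hw₁ w₂ hw₂ e₁ e₂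
  obtain ⟨b, hb, eb⟩ := hpol w₁ hw₁ e₁
  obtain ⟨a, ha, ea⟩ := hpol w₂ hw₂ e₂
  rw [eb, ea]
  exact hxQ a ha b hb

lemma trace_est (ch : FwdLoewnerChain lam 1) {γ : ℝ → ℂ} (hγ : HasTrace lam 1 ch γ)
    {c₀ β y₀ : ℝ} (hc₀ : 0 < c₀) (hβ1 : β < 1)
    (hd : ∀ t ∈ Set.Icc (0:ℝ) 1, ∀ y : ℝ, 0 < y → y ≤ y₀ →
            ‖deriv (fun z => ch.finv t (z + (lam t : ℂ))) ((y : ℂ) * Complex.I)‖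
              ≤ c₀ * y ^ (-β)) {u : ℝ} (hu : u ∈ Set.Icc (0:ℝ) 1) {y : ℝ} (hy : 0 < y)
    (hy0 : y ≤ y₀) :
    ‖ch.finv u (lam u + y * Complex.I) - γ u‖ ≤ c₀ / (1 - β) * y ^ (1 - β) := by
  have hb : 0 < 1 - β := by linarith
  let F : ℝ → ℂ := fun y => ch.finv u (lam u + y * Complex.I)
  have hF : ∀ r : ℝ, 0 < r → HasDerivAt F
      (deriv (fun z => ch.finv u (z + (lam u : ℂ))) ((r : ℂ) * Complex.I) * Complex.I) r := by
    intro r hr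
    have hopen : IsOpen UHP := isOpen_lt continuous_const Complex.continuous_im
    have hm : ((r : ℂ) * Complex.I + lam u) ∈ UHP := by
      show 0 < ((r : ℂ) * Complex.I + lam u).im
      simpa using hr
    have h1 : DifferentiableAt ℂ (fun z => ch.finv u (z + (lam u : ℂ))) ((r : ℂ) * Complex.I) := by
      have := ((ch.finv_holo u hu) _ hm).differentiableAt (hopen.mem_nhds hm)
      exact DifferentiableAt.comp _ this (by fun_prop)
    have h' : HasDerivAt (fun y : ℝ => (y * Complex.I : ℂ)) Complex.I r := by
      simpa using (Complex.ofRealCLM.hasDerivAt (x := r)).mul_const Complex.I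
    have h2 := HasDerivAt.comp r h1.hasDerivAt h'
    refine h2.congr_of_eventuallyEq (Filter.Eventually.of_forall fun y => ?_)
    simp only [F, Function.comp]
    rw [add_comm]
  have hest : ∀ x ∈ Set.Ioc 0 y, ‖F y - F x‖ ≤ c₀ / (1 - β) * y ^ (1 - β) := by
    intro x hx
    let B : ℝ → ℝ := fun r => c₀ / (1 - β) * (r ^ (1 - β) - x ^ (1 - β))
    have hB : ∀ r, 0 < r → HasDerivAt B (c₀ * r ^ (-β)) r := by
      intro r hr
      have := ((Real.hasDerivAt_rpow_const (x := r) (p := 1 - β) (Or.inl hr.ne')).sub_const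
        (x ^ (1 - β))).const_mul (c₀ / (1 - β))
      have e : c₀ / (1 - β) * ((1 - β) * r ^ (1 - β - 1)) = c₀ * r ^ (-β) := by
        rw [show 1 - β - 1 = -β by ring]
        field_simp
      rw [e] at this
      exact this
    have := image_norm_le_of_norm_deriv_right_le_deriv_boundary' (f := fun r => F r - F x)
      (a := x) (b := y)
      (f' := fun r => deriv (fun z => ch.finv u (z + (lam u : ℂ))) ((r : ℂ) * Complex.I) * Complex.I)
      (B := B) (B' := fun r => c₀ * r ^ (-β))
      (fun r hr => ((hF r (hx.1.trans_le hr.1)).sub_const _).continuousAt.continuousWithinAt)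
      (fun r hr => ((hF r (hx.1.trans_le hr.1)).sub_const _).hasDerivWithinAt)
      (by simp [B])
      (fun r hr => (hB r (hx.1.trans_le hr.1)).continuousAt.continuousWithinAt)
      (fun r hr => (hB r (hx.1.trans_le hr.1)).hasDerivWithinAt)
      (fun r hr => by
        rw [norm_mul, Complex.norm_I, mul_one]
        exact hd u hu r (hx.1.trans_le hr.1) (hr.2.le.trans hy0))
      (Set.right_mem_Icc.2 hx.2)
    refine this.trans ?_
    simp only [B]
    have h3 : 0 ≤ x ^ (1 - β) := Real.rpow_nonneg hx.1.le _
    gcongr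
    linarith
  have hlim := hγ.2 u hu
  have hlim2 : Tendsto (fun x => ‖F y - F x‖) (nhdsWithin 0 (Set.Ioi 0)) (nhds ‖F y - γ u‖) :=
    (tendsto_const_nhds.sub hlim).norm
  refine le_of_tendsto hlim2 ?_
  filter_upwards [Ioc_mem_nhdsGT hy] with x hx
  exact hest x hx

end arcs

/-! ### The trace hits every swallowed segment -/

section hit
variable {lam : ℝ → ℝ}

lemma close_approach (ch : FwdLoewnerChain lam 1) (hlam : ContinuousOn lam (Set.Icc 0 1))
    {t T c d : ℝ} (ht : 0 ≤ t) (htT : t ≤ T) (hT : T ≤ 1) (hc : 0 < c) (hd : 0 < d) {J : Set ℂ}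
    (hJ : J ⊆ ch.H t) (hJc : ∀ z ∈ J, c ≤ (ch.g t z).im) (hJT : ¬ J ⊆ ch.H T) :
    ∃ s ∈ Set.Icc t T, J ⊆ ch.H s ∧ ∃ z ∈ J, ‖ch.g s z - lam s‖ < d := by
  by_contra hcon
  push Not at hcon
  apply hJT
  refine ch_survive ch hlam ht htT hT (c := c * Real.exp (-(2 / d ^ 2 * (T - t)))) (by positivity)
    J hJ ?_
  intro s hs hJs z hz
  have := far_im ch ht hs hT hd (hJs hz) (by
    intro r hr
    refine hcon r ⟨hr.1, hr.2.trans hs.2⟩ ?_ z hz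
    intro x hx
    exact ch_mono ch (ht.trans hr.1) hr.2 (hs.2.trans hT) (hJs hx))
  refine le_trans ?_ this
  have := hJc z hz
  gcongr

lemma trace_hits (ch : FwdLoewnerChain lam 1) (hlam : ContinuousOn lam (Set.Icc 0 1))
    {γ : ℝ → ℂ} (hγ : HasTrace lam 1 ch γ)
    {c₀ β y₀ : ℝ} (hc₀ : 0 < c₀) (hβ1 : β < 1) (hy₀ : 0 < y₀)
    (hd : ∀ t ∈ Set.Icc (0:ℝ) 1, ∀ y : ℝ, 0 < y → y ≤ y₀ →
            ‖deriv (fun z => ch.finv t (z + (lam t : ℂ))) ((y : ℂ) * Complex.I)‖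
              ≤ c₀ * y ^ (-β))
    {t T a b x d : ℝ} (ht : 0 ≤ t) (htT : t ≤ T) (hT : T ≤ 1) (ha : 0 < a) (hab : a ≤ b)
    (hd0 : 0 < d) (hb : d ^ 2 ≤ b ^ 2 - 4 * (T - t))
    (hsw : ch.finv t (x + a * Complex.I) ∉ ch.H T) :
    ∃ s ∈ Set.Icc t T, ∃ y ∈ Set.Icc a b, γ s = ch.finv t (x + y * Complex.I) := by
  have htI : t ∈ Set.Icc (0:ℝ) 1 := ⟨ht, htT.trans hT⟩
  let P : ℝ → ℂ := fun y => ch.finv t (x + y * Complex.I)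
  have hmem : ∀ y ∈ Set.Icc a b, (x + y * Complex.I : ℂ) ∈ UHP := by
    intro y hy
    show 0 < (x + y * Complex.I : ℂ).im
    simpa using ha.trans_le hy.1
  have hPc : ContinuousOn P (Set.Icc a b) :=
    (ch.finv_holo t htI).continuousOn.comp (Continuous.continuousOn (by fun_prop)) hmem
  have hPH : ∀ y ∈ Set.Icc a b, P y ∈ ch.H t ∧ ch.g t (P y) = x + y * Complex.I :=
    fun y hy => ch.finv_maps t htI _ (hmem y hy)
  set J := P '' Set.Icc a b with hJdef
  have hJ : J ⊆ ch.H t := by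
    rintro _ ⟨y, hy, rfl⟩
    exact (hPH y hy).1
  have hJc : ∀ z ∈ J, a ≤ (ch.g t z).im := by
    rintro _ ⟨y, hy, rfl⟩
    rw [(hPH y hy).2]
    simpa using hy.1
  have hJT : ¬ J ⊆ ch.H T := fun h => hsw (h ⟨a, Set.left_mem_Icc.2 hab, rfl⟩)
  have hJcomp : IsCompact J := isCompact_Icc.image_of_continuousOn hPc
  have hbI := Set.right_mem_Icc.2 hab
  have hhigh := high_survive ch hlam ht htT hT hd0 (hPH b hbI).1 (by
    rw [(hPH b hbI).2]; simpa using hb)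
  have hγc : IsCompact (γ '' Set.Icc t T) :=
    isCompact_Icc.image_of_continuousOn (hγ.1.mono (Set.Icc_subset_Icc ht hT))
  by_contra hcon
  push Not at hcon
  have hdisj : Disjoint (γ '' Set.Icc t T) J := by
    rw [Set.disjoint_left]
    rintro _ ⟨s, hs, rfl⟩ ⟨y, hy, e⟩
    exact hcon s hs y hy e.symm
  obtain ⟨r, hr0, hr⟩ := Metric.exists_pos_forall_lt_edist hγc hJcomp.isClosed hdisj
  have hrR : ∀ s ∈ Set.Icc t T, ∀ z ∈ J, (r : ℝ) < ‖γ s - z‖ := by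
    intro s hs z hz
    have := hr _ ⟨s, hs, rfl⟩ z hz
    rw [edist_dist, ← ENNReal.ofReal_coe_nnreal, ENNReal.ofReal_lt_ofReal_iff_of_nonneg r.coe_nonneg,
      dist_eq_norm] at this
    exact this
  have hr0' : (0:ℝ) < r := hr0
  set ε := (r : ℝ) / 2 with hε
  have hε0 : 0 < ε := by positivity
  obtain ⟨N₀, hN₀⟩ := small_arc ch hlam hε0
  have hexp : Tendsto (fun N : ℝ => Real.exp (-N)) atTop (nhds 0) := Real.tendsto_exp_neg_atTop_nhds_zero
  have hb1 : 0 < 1 - β := by linarith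
  have hpow : Tendsto (fun N : ℝ => c₀ / (1 - β) * Real.exp (-N) ^ (1 - β)) atTop (nhds 0) := by
    have := (hexp.rpow_const (p := 1 - β) (Or.inr hb1.le)).const_mul (c₀ / (1 - β))
    rwa [Real.zero_rpow hb1.ne', mul_zero] at this
  obtain ⟨N, h1, h2, h3, h4, h5⟩ := ((hpow.eventually_lt_const hε0).and
    ((hexp.eventually_lt_const hy₀).and ((hexp.eventually_lt_const hd0).and
      ((Filter.eventually_ge_atTop N₀).and (Filter.eventually_gt_atTop 0))))).exists
  obtain ⟨s, hs, hJs, z, ⟨y₁, hy₁, rfl⟩, hz⟩ := close_approach ch hlam ht htT hT ha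
    (Real.exp_pos (-2 * N)) hJ hJc hJT
  have hsI : s ∈ Set.Icc (0:ℝ) 1 := ⟨ht.trans hs.1, hs.2.trans hT⟩
  obtain ⟨ρ, hρ, hρQ⟩ := hN₀ N h4 h5 s hsI
  have hρ0 : 0 < ρ := (Real.exp_pos _).trans hρ.1
  -- intermediate value theorem
  let f : ℝ → ℝ := fun y => ‖ch.g s (P y) - lam s‖
  have hf : ContinuousOn f (Set.Icc y₁ b) := by
    have : ContinuousOn (fun y => ch.g s (P y)) (Set.Icc a b) :=
      (ch.g_holo s hsI).continuousOn.comp hPc fun y hy => hJs ⟨y, hy, rfl⟩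
    exact ((this.mono (Set.Icc_subset_Icc hy₁.1 le_rfl)).sub continuousOn_const).norm
  have hfb : d ≤ f b := by
    have h6 := (hhigh s hs).2
    have h7 := Complex.abs_im_le_norm (ch.g s (P b) - lam s)
    simp only [Complex.sub_im, Complex.ofReal_im, sub_zero] at h7
    exact h6.trans ((le_abs_self _).trans h7)
  obtain ⟨y₂, hy₂, hfy⟩ := intermediate_value_Icc hy₁.2 hf
    (show ρ ∈ Set.Icc (f y₁) (f b) from
      ⟨(hz.trans hρ.1).le, (hρ.2.trans h3).le.trans hfb⟩)
  have hy₂' : y₂ ∈ Set.Icc a b := ⟨hy₁.1.trans hy₂.1, hy₂.2⟩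
  have hzJ : P y₂ ∈ J := ⟨y₂, hy₂', rfl⟩
  have e1 := hρQ (ch.g s (P y₂)) ((ch.bijOn s hsI).mapsTo (hJs hzJ)) (lam s + ρ * Complex.I)
    (by show 0 < (lam s + ρ * Complex.I : ℂ).im; simpa using hρ0) hfy
    (by simp [abs_of_pos hρ0])
  rw [ch_left ch hsI (hJs hzJ)] at e1
  have e2 := trace_est ch hγ hc₀ hβ1 hd hsI hρ0 (hρ.2.trans h2).le
  have e3 : c₀ / (1 - β) * ρ ^ (1 - β) < ε := by
    refine lt_of_le_of_lt ?_ h1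
    have := hρ.2.le
    gcongr
  have e4 := hrR s hs _ hzJ
  have e5 : ‖γ s - P y₂‖ ≤ ‖P y₂ - ch.finv s (lam s + ρ * Complex.I)‖ +
      ‖ch.finv s (lam s + ρ * Complex.I) - γ s‖ := by
    rw [norm_sub_rev (γ s)]
    exact norm_sub_le_norm_sub_add_norm_sub _ _ _
  linarith

lemma osc_bound (hlam : ContinuousOn lam (Set.Icc 0 1)) {δ s t : ℝ} (hs : s ∈ Set.Icc (0:ℝ) 1)
    (ht : t ∈ Set.Icc (0:ℝ) 1) (h : |t - s| ≤ δ) : |lam t - lam s| ≤ osc lam δ := by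
  obtain ⟨Λ, hΛ⟩ := isCompact_Icc.exists_bound_of_continuousOn hlam
  refine le_csSup ⟨2 * Λ, ?_⟩ ⟨s, hs, t, ht, h, rfl⟩
  rintro _ ⟨a, ha, b, hb, -, rfl⟩
  have h1 := hΛ a ha
  have h2 := hΛ b hb
  have := norm_sub_le (lam b) (lam a)
  rw [← Real.norm_eq_abs]
  linarith

lemma subpower_aux {φ : ℝ → ℝ} (hφ : IsSubpower φ) : IsSubpower (fun x => 4 * φ x + 16) := by
  refine ⟨fun x => by have := hφ.1 x; positivity, fun ε hε => ?_⟩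
  have h1 := (hφ.2 ε hε).const_mul 4
  have h2 := (tendsto_rpow_atTop hε).inv_tendsto_atTop.const_mul (16:ℝ)
  have h3 := h1.add h2
  simp only [mul_zero, add_zero] at h3
  refine h3.congr fun x => ?_
  simp only [Pi.inv_apply]
  ring

end hit

/-- **Good points on the trace land in the box `A_{n,2√2,ψ}`** (Tran, Lemma 3.2).
Under Assumptions 1 (with subpower function `φ`) and 2 (with constants `c₀, y₀, β`) on the
driver `lam`, there is a subpower function `ψ` depending only on `φ`, `c₀` and `β` such that
for every `n ≥ 1` and `0 ≤ k ≤ n−1` (with `t_k = k/n`) there exists `s ∈ [0, 2/n]` with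
`γ_k(s) := g_{t_k}(γ(t_k + s)) − lam(t_k) ∈ A_{n, 2√2, ψ}`. -/
theorem trace_point_in_box
    (φ : ℝ → ℝ) (hφ : IsSubpower φ) (c₀ β : ℝ) (hc₀ : 0 < c₀) (hβ0 : 0 < β) (hβ1 : β < 1) :
    ∃ ψ : ℝ → ℝ, IsSubpower ψ ∧
      ∀ (lam : ℝ → ℝ), ContinuousOn lam (Set.Icc 0 1) →
        (∀ δ ∈ Set.Ioc (0:ℝ) 1, osc lam δ ≤ Real.sqrt δ * φ (1/δ)) →
        ∀ y₀ : ℝ, 0 < y₀ →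
        ∀ ch : FwdLoewnerChain lam 1,
        (∀ t ∈ Set.Icc (0:ℝ) 1, ∀ y : ℝ, 0 < y → y ≤ y₀ →
            ‖deriv (fun z => ch.finv t (z + (lam t : ℂ))) ((y : ℂ) * Complex.I)‖
              ≤ c₀ * y ^ (-β)) →
        ∀ γ : ℝ → ℂ, HasTrace lam 1 ch γ →
        ∀ n : ℕ, 1 ≤ n → ∀ k : ℕ, k ≤ n - 1 →
          ∃ s ∈ Set.Icc (0:ℝ) (2 / n),
            ch.g ((k : ℝ) / n) (γ ((k : ℝ) / n + s)) - ((lam ((k : ℝ) / n) : ℂ))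
              ∈ boxA n (2 * Real.sqrt 2) ψ := by
  refine ⟨fun x => 4 * φ x + 16, subpower_aux hφ, ?_⟩
  intro lam hlam hosc y₀ hy₀ ch hd γ hγ n hn k hk
  have hn0 : (0:ℝ) < n := by exact_mod_cast hn
  have hn1 : (1:ℝ) ≤ n := by exact_mod_cast hn
  have hk1 : (k:ℝ) + 1 ≤ n := by
    have : k + 1 ≤ n := by omega
    exact_mod_cast this
  have hφ0 := hφ.1 n
  set t : ℝ := (k : ℝ) / n with ht_def
  set T : ℝ := t + 1 / n with hT_def
  set q : ℝ := 1 / Real.sqrt n with hq_def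
  have hsn : 0 < Real.sqrt n := Real.sqrt_pos.2 hn0
  have hq : 0 < q := by positivity
  have hq2 : q ^ 2 = 1 / n := by
    rw [hq_def, div_pow, Real.sq_sqrt hn0.le, one_pow]
  have ht : 0 ≤ t := by positivity
  have hinv : 0 < 1 / (n:ℝ) := by positivity
  have htT : t ≤ T := by linarith
  have hT : T ≤ 1 := by
    rw [hT_def, ht_def, ← add_div, div_le_one hn0]
    exact hk1
  have hqT : T - t = q ^ 2 := by rw [hq2, hT_def]; ring
  have htI : t ∈ Set.Icc (0:ℝ) 1 := ⟨ht, htT.trans hT⟩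
  set W : ℝ := φ n * q with hW_def
  have hW : ∀ r ∈ Set.Icc t T, |lam r - lam t| ≤ W := by
    intro r hr
    have h1 := osc_bound (δ := 1 / n) hlam htI ⟨ht.trans hr.1, hr.2.trans hT⟩ (by
      rw [abs_of_nonneg (by linarith [hr.1])]
      linarith [hr.2])
    have h2 := hosc (1 / n) ⟨hinv, by rw [div_le_one hn0]; exact hn1⟩
    rw [one_div_one_div, Real.sqrt_div zero_le_one, Real.sqrt_one] at h2
    rw [hW_def, mul_comm]
    exact h1.trans h2
  obtain ⟨w, hwη, hwT⟩ := exists_swallowed ch ht htT hT hW hq hqT rfl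
  have hη : 1 / (Real.sqrt n * (4 * φ n + 16)) = q ^ 2 / (4 * (W + 4 * q)) := by
    rw [hW_def, hq_def]
    field_simp
    ring
  have hη0 : 0 < q ^ 2 / (4 * (W + 4 * q)) := by positivity
  have hw0 : 0 < w.im := hη0.trans_le hwη
  obtain ⟨hwH, hwg⟩ := ch.finv_maps t htI w hw0
  have hsq2 : Real.sqrt 2 ^ 2 = 2 := Real.sq_sqrt (by norm_num)
  have hs2 : 0 < Real.sqrt 2 := Real.sqrt_pos.2 (by norm_num)
  have hb2 : (2 * Real.sqrt 2 * q) ^ 2 = 8 * q ^ 2 := by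
    rw [mul_pow, mul_pow, hsq2]; ring
  have hwb : w.im ≤ 2 * Real.sqrt 2 * q := by
    by_contra hc
    push Not at hc
    apply hwT
    refine (high_survive ch hlam ht htT hT (c := 2 * q) (by positivity) hwH ?_ T
      (Set.right_mem_Icc.2 htT)).1
    rw [hwg, hqT]
    have : (2 * Real.sqrt 2 * q) ^ 2 ≤ w.im ^ 2 := by gcongr
    nlinarith
  have hwre : |w.re - lam t| ≤ W := by
    by_contra hc
    push Not at hc
    exact hwT (re_survive ch hlam ht htT hT hW hwH (by rw [hwg]; exact hc))
  obtain ⟨s, hs, y, hy, hγs⟩ := trace_hits ch hlam hγ hc₀ hβ1 hy₀ hd (x := w.re) (d := 2 * q)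
    ht htT hT hw0 hwb (by positivity) (by rw [hb2, hqT]; nlinarith)
    (by rw [Complex.re_add_im]; exact hwT)
  refine ⟨s - t, ⟨by linarith [hs.1], ?_⟩, ?_⟩
  · have h1 := hs.2
    have h2 : (2:ℝ) / n = 1 / n + 1 / n := by ring
    linarith
  · have hy0 : 0 < y := hw0.trans_le hy.1
    rw [add_sub_cancel, hγs, (ch.finv_maps t htI _ (by
      show 0 < (w.re + y * Complex.I : ℂ).im
      simpa using hy0)).2]
    have him : ((w.re : ℂ) + y * Complex.I - lam t).im = y := by simp
    have hre : ((w.re : ℂ) + y * Complex.I - lam t).re = w.re - lam t := by simp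
    refine ⟨?_, ?_, ?_, ?_⟩
    · rw [him]; exact hy0
    · rw [hre]
      refine hwre.trans ?_
      rw [hW_def, hq_def, mul_one_div]
      gcongr
      linarith
    · rw [him, hη]; exact hwη.trans hy.1
    · rw [him]
      refine hy.2.trans (le_of_eq ?_)
      rw [hq_def, mul_one_div]

end
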